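/- Let α ∈ (0,1) and let r satisfy 1 ≤ r ≤ (2−α)/α. Let the temporal mesh satisfy the weaker quasi-gradedness condition: c_0 M^{−r} ≤ τ ≤ C_0 M^{−r} and τ_j ≤ C_0 τ^{1/r} t_j^{1−1/r} for all j = 1,...,M, with constants 0 < c_0 ≤ C_0. Then there exists a constant C > 0, depending only on α, γ, r, T, c_0, C_0, such that: for every γ ∈ ℝ and every real sequence V^0,...,V^M with V^0 = 0 and |δ_t^α V^j| ≤ (τ/t_j)^{γ+1} for all j = 1,...,M, one has |V^j| ≤ C 𝒱^j for all j = 1,...,M. -/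

import Mathlib

open Real MeasureTheory Set

/-- The L1 discrete fractional-derivative operator associated with the mesh `t`,
applied to the sequence `V`, at time level `m`. -/
noncomputable def deltaL1 (α : ℝ) (t : ℕ → ℝ) (V : ℕ → ℝ) (m : ℕ) : ℝ :=
  (1 / Real.Gamma (1 - α)) *
    ∑ j ∈ Finset.Icc 1 m,
      ((V j - V (j - 1)) / (t j - t (j - 1))) *
        ∫ s in (t (j - 1))..(t j), (t m - s) ^ (-α)

/-- `t 0 = 0 < t 1 < ... < t M = T` with `M ≥ 2`. -/
def IsMesh (T : ℝ) (M : ℕ) (t : ℕ → ℝ) : Prop :=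
  2 ≤ M ∧ t 0 = 0 ∧ (∀ j, j < M → t j < t (j + 1)) ∧ t M = T

/-- Quasi-graded mesh with parameter `r` and constants `c0 ≤ C0`. -/
def QuasiGraded (r c0 C0 : ℝ) (M : ℕ) (t : ℕ → ℝ) : Prop :=
  (c0 * (M : ℝ) ^ (-r) ≤ t 1 ∧ t 1 ≤ C0 * (M : ℝ) ^ (-r)) ∧
  (∀ j : ℕ, 1 ≤ j → j ≤ M →
    c0 * (t 1 * (j : ℝ) ^ r) ≤ t j ∧ t j ≤ C0 * (t 1 * (j : ℝ) ^ r)) ∧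
  (∀ j : ℕ, 1 ≤ j → j ≤ M →
    c0 * ((t 1) ^ (1 / r) * (t j) ^ (1 - 1 / r)) ≤ t j - t (j - 1) ∧
    t j - t (j - 1) ≤ C0 * ((t 1) ^ (1 / r) * (t j) ^ (1 - 1 / r)))

/-- The stability majorant `𝒱^j`. -/
noncomputable def Vcal (α γ τ tj : ℝ) : ℝ :=
  if 0 < γ then τ * tj ^ (α - 1)
  else if γ = 0 then τ * tj ^ (α - 1) * (1 + Real.log (tj / τ))
  else τ * tj ^ (α - 1) * (τ / tj) ^ γ

/-- Weaker quasi-gradedness condition (2.10): only the first-interval bounds and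
the upper bound on the local mesh widths are required. -/
def WeakQuasiGraded (r c0 C0 : ℝ) (M : ℕ) (t : ℕ → ℝ) : Prop :=
  (c0 * (M : ℝ) ^ (-r) ≤ t 1 ∧ t 1 ≤ C0 * (M : ℝ) ^ (-r)) ∧
  (∀ j : ℕ, 1 ≤ j → j ≤ M →
    t j - t (j - 1) ≤ C0 * ((t 1) ^ (1 / r) * (t j) ^ (1 - 1 / r)))

theorem one_add_mul_sub_one_le_rpow {x p : ℝ} (hx : 0 < x) (hp : p ≤ 0) :
    1 + p * (x - 1) ≤ x ^ p := by
  have h1 := Real.add_one_le_exp (Real.log x * p)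
  rw [← Real.rpow_def_of_pos hx] at h1
  nlinarith [Real.log_le_sub_one_of_pos hx]

theorem rpow_tangent_le {x y p : ℝ} (hx : 0 < x) (hy : 0 < y) (hp : p ≤ 0) :
    x ^ p + p * (y - x) * x ^ (p - 1) ≤ y ^ p := by
  have h := one_add_mul_sub_one_le_rpow (div_pos hy hx) hp
  rw [Real.div_rpow hy.le hx.le, le_div_iff₀ (Real.rpow_pos_of_pos hx p)] at h
  rw [Real.rpow_sub_one hx.ne']
  calc _ = (1 + p * (y / x - 1)) * x ^ p := by field_simp
    _ ≤ _ := h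

theorem rpow_le_tangent {x y q : ℝ} (hx : 0 < x) (hy : 0 ≤ y) (hq0 : 0 ≤ q) (hq1 : q ≤ 1) :
    y ^ q ≤ x ^ q + q * (y - x) * x ^ (q - 1) := by
  have h := rpow_one_add_le_one_add_mul_self (s := y / x - 1)
    (by linarith [div_nonneg hy hx.le]) hq0 hq1
  rw [add_sub_cancel, Real.div_rpow hy hx.le, div_le_iff₀ (Real.rpow_pos_of_pos hx q)] at h
  rw [Real.rpow_sub_one hx.ne']
  calc _ ≤ _ := h
    _ = _ := by field_simp

/-- The integral of `(x - s) ^ (-α)` over `[u, v]`. -/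
noncomputable def kernelInt (α x u v : ℝ) : ℝ :=
  ((x - u) ^ (1 - α) - (x - v) ^ (1 - α)) / (1 - α)

theorem integral_kernel {α : ℝ} (hα1 : α < 1) (x u v : ℝ) :
    ∫ s in u..v, (x - s) ^ (-α) = kernelInt α x u v := by
  rw [intervalIntegral.integral_comp_sub_left (fun s => s ^ (-α)), integral_rpow (by left; linarith),
    kernelInt]
  ring_nf

theorem le_kernelInt {α x u v : ℝ} (hα0 : 0 < α) (hα1 : α < 1) (hux : u < x) (hvx : v ≤ x) :
    (v - u) * (x - u) ^ (-α) ≤ kernelInt α x u v := by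
  have h := rpow_le_tangent (x := x - u) (y := x - v) (q := 1 - α) (by linarith) (by linarith)
    (by linarith) (by linarith)
  rw [show 1 - α - 1 = -α by ring] at h
  rw [kernelInt, le_div_iff₀ (by linarith)]
  linarith

theorem kernelInt_le {α x u v : ℝ} (hα0 : 0 < α) (hα1 : α < 1) (hux : u ≤ x) (hvx : v < x) :
    kernelInt α x u v ≤ (v - u) * (x - v) ^ (-α) := by
  have h := rpow_le_tangent (x := x - v) (y := x - u) (q := 1 - α) (by linarith) (by linarith)
    (by linarith) (by linarith)
  rw [show 1 - α - 1 = -α by ring] at h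
  rw [kernelInt, div_le_iff₀ (by linarith)]
  linarith

/-- The L1 sum over the first `n` mesh intervals, evaluated at the point `x`, without the Gamma
factor. -/
noncomputable def l1Sum (α : ℝ) (t V : ℕ → ℝ) (x : ℝ) (n : ℕ) : ℝ :=
  ∑ i ∈ Finset.range n, (V (i + 1) - V i) * (kernelInt α x (t i) (t (i + 1)) / (t (i + 1) - t i))

theorem l1Sum_succ (α : ℝ) (t V : ℕ → ℝ) (x : ℝ) (n : ℕ) :
    l1Sum α t V x (n + 1) = l1Sum α t V x n +
      (V (n + 1) - V n) * (kernelInt α x (t n) (t (n + 1)) / (t (n + 1) - t n)) :=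
  Finset.sum_range_succ _ _

theorem deltaL1_eq {α : ℝ} (hα1 : α < 1) (t V : ℕ → ℝ) (m : ℕ) :
    deltaL1 α t V m = 1 / Real.Gamma (1 - α) * l1Sum α t V (t m) m := by
  have h : ∀ x n, ∑ j ∈ Finset.Icc 1 n, ((V j - V (j - 1)) / (t j - t (j - 1))) *
      ∫ s in (t (j - 1))..(t j), (x - s) ^ (-α) = l1Sum α t V x n := by
    intro x n
    induction n with
    | zero => simp [l1Sum]
    | succ n ih =>
      rw [Finset.sum_Icc_succ_top (by omega), ih, l1Sum_succ, integral_kernel hα1,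
        Nat.add_sub_cancel]
      ring
  rw [deltaL1, h]

theorem l1Sum_mul_sub (α : ℝ) (t V W : ℕ → ℝ) (c x : ℝ) (n : ℕ) :
    l1Sum α t (fun j => c * W j - V j) x n = c * l1Sum α t W x n - l1Sum α t V x n := by
  simp only [l1Sum, Finset.mul_sum, ← Finset.sum_sub_distrib]
  exact Finset.sum_congr rfl fun i _ => by ring

theorem l1Sum_neg (α : ℝ) (t V : ℕ → ℝ) (x : ℝ) (n : ℕ) :
    l1Sum α t (fun j => -V j) x n = -l1Sum α t V x n := by
  simp only [l1Sum, ← Finset.sum_neg_distrib]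
  exact Finset.sum_congr rfl fun i _ => by ring

theorem l1Sum_sum (α : ℝ) (t : ℕ → ℝ) (s : Finset ℕ) (w : ℕ → ℝ) (B : ℕ → ℕ → ℝ) (x : ℝ) (n : ℕ) :
    l1Sum α t (fun j => ∑ p ∈ s, w p * B p j) x n = ∑ p ∈ s, w p * l1Sum α t (B p) x n := by
  simp only [l1Sum, Finset.mul_sum, ← Finset.sum_sub_distrib, Finset.sum_mul]
  rw [Finset.sum_comm]
  exact Finset.sum_congr rfl fun p _ => Finset.sum_congr rfl fun i _ => by ring

theorem sum_mul_sub_le_of_monotone {κ U : ℕ → ℝ} {n : ℕ}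
    (hκ0 : 0 ≤ κ 0) (hκ : ∀ i < n, κ i ≤ κ (i + 1)) (hU : ∀ i ≤ n, 0 ≤ U i) :
    ∑ i ∈ Finset.range (n + 1), (U (i + 1) - U i) * κ i ≤ κ n * U (n + 1) := by
  induction n with
  | zero =>
    simp only [zero_add, Finset.range_one, Finset.sum_singleton]
    nlinarith [mul_nonneg hκ0 (hU 0 le_rfl)]
  | succ n ih =>
    rw [Finset.sum_range_succ]
    have h := ih (fun i hi => hκ i (by omega)) (fun i hi => hU i (by omega))
    nlinarith [mul_nonneg (sub_nonneg.2 (hκ n (by omega))) (hU (n + 1) le_rfl)]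

/-- Discrete comparison principle for the L1 operator. -/
theorem nonneg_of_l1Sum_nonneg {α : ℝ} (hα0 : 0 < α) (hα1 : α < 1) {t U : ℕ → ℝ} {m : ℕ}
    (ht : StrictMonoOn t (Iic m)) (hU0 : 0 ≤ U 0)
    (hU : ∀ j, 1 ≤ j → j ≤ m → 0 ≤ l1Sum α t U (t j) j) : ∀ j ≤ m, 0 ≤ U j := by
  intro j
  induction j using Nat.strong_induction_on with
  | _ j ih =>
    intro hj
    obtain _ | n := j
    · exact hU0
    have hlt : ∀ i k, i < k → k ≤ m → t i < t k := fun i k hik hk =>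
      ht (mem_Iic.2 (by omega)) (mem_Iic.2 hk) hik
    have hle : ∀ i k, i ≤ k → k ≤ m → t i ≤ t k := fun i k hik hk =>
      ht.monotoneOn (mem_Iic.2 (by omega)) (mem_Iic.2 hk) hik
    have hlow : ∀ i ≤ n, (t (n + 1) - t i) ^ (-α) ≤
        kernelInt α (t (n + 1)) (t i) (t (i + 1)) / (t (i + 1) - t i) := by
      intro i hi
      rw [le_div_iff₀ (sub_pos.2 (hlt i (i + 1) (by omega) (by omega))), mul_comm]
      exact le_kernelInt hα0 hα1 (hlt _ _ (by omega) hj) (hle _ _ (by omega) hj)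
    have hpos : ∀ i ≤ n, 0 < (t (n + 1) - t i) ^ (-α) := fun i hi =>
      Real.rpow_pos_of_pos (sub_pos.2 (hlt _ _ (by omega) hj)) _
    have h1 := hU (n + 1) (by omega) hj
    have h2 := sum_mul_sub_le_of_monotone (n := n) (U := U)
      (κ := fun i => kernelInt α (t (n + 1)) (t i) (t (i + 1)) / (t (i + 1) - t i))
      ((hpos 0 (by omega)).le.trans (hlow 0 (by omega)))
      (fun i hi => by
        refine le_trans ?_ (hlow (i + 1) (by omega))
        rw [div_le_iff₀ (sub_pos.2 (hlt i (i + 1) (by omega) (by omega))), mul_comm]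
        exact kernelInt_le hα0 hα1 (hle _ _ (by omega) hj) (hlt _ _ (by omega) hj))
      (fun i hi => ih i (by omega) (by omega))
    exact nonneg_of_mul_nonneg_right (h1.trans h2) ((hpos n le_rfl).trans_le (hlow n le_rfl))

/-- An antiderivative in `s` of `(α - 1) * s ^ (α - 2) * (x - s) ^ (-α)`. -/
noncomputable def powPrim (α x s : ℝ) : ℝ := s ^ (α - 1) * (x - s) ^ (1 - α) / x

theorem hasDerivAt_powPrim {α x s : ℝ} (hs : 0 < s) (hsx : s < x) :
    HasDerivAt (powPrim α x) ((α - 1) * s ^ (α - 2) * (x - s) ^ (-α)) s := by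
  have h1 : HasDerivAt (fun y : ℝ => y ^ (α - 1)) (1 * (α - 1) * s ^ (α - 1 - 1)) s :=
    (hasDerivAt_id s).rpow_const (Or.inl hs.ne')
  have h2 : HasDerivAt (fun y : ℝ => (x - y) ^ (1 - α))
      (-1 * (1 - α) * (x - s) ^ (1 - α - 1)) s :=
    ((hasDerivAt_id s).const_sub x).rpow_const (Or.inl (sub_pos.2 hsx).ne')
  refine ((h1.mul h2).div_const x).congr_deriv ?_
  have hx : x ≠ 0 := (hs.trans hsx).ne'
  have e1 : s ^ (α - 1) = s ^ (α - 2) * s := by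
    rw [← Real.rpow_add_one hs.ne']; congr 1; ring
  have e2 : (x - s) ^ (1 - α) = (x - s) ^ (-α) * (x - s) := by
    rw [← Real.rpow_add_one (sub_pos.2 hsx).ne']; congr 1; ring
  rw [e1, e2, show α - 1 - 1 = α - 2 by ring, show 1 - α - 1 = -α by ring]
  field_simp
  ring

theorem hasDerivAt_kernelInt {α x u s : ℝ} (hα1 : α < 1) (hsx : s < x) :
    HasDerivAt (kernelInt α x u) ((x - s) ^ (-α)) s := by
  have h2 : HasDerivAt (fun y : ℝ => (x - y) ^ (1 - α))
      (-1 * (1 - α) * (x - s) ^ (1 - α - 1)) s :=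
    ((hasDerivAt_id s).const_sub x).rpow_const (Or.inl (sub_pos.2 hsx).ne')
  refine ((h2.const_sub ((x - u) ^ (1 - α))).div_const (1 - α)).congr_deriv ?_
  rw [show 1 - α - 1 = -α by ring]
  have : 1 - α ≠ 0 := by linarith
  field_simp

theorem interp_ge_powPrim {α x u v : ℝ} (hα0 : 0 < α) (hα1 : α < 1) (hu : 0 < u) (huv : u < v)
    (hvx : v ≤ x) :
    powPrim α x v - powPrim α x u - (1 - α) * (u ^ (α - 2) - v ^ (α - 2)) *
        (kernelInt α x u v - (v - u) * (x - u) ^ (-α)) ≤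
      (v ^ (α - 1) - u ^ (α - 1)) * (kernelInt α x u v / (v - u)) := by
  set S := (v ^ (α - 1) - u ^ (α - 1)) / (v - u) with hS
  set D := (1 - α) * (u ^ (α - 2) - v ^ (α - 2)) with hD
  set w := (x - u) ^ (-α) with hw
  have hvu : 0 < v - u := sub_pos.2 huv
  have hSu : (α - 1) * u ^ (α - 2) ≤ S := by
    rw [hS, le_div_iff₀ hvu]
    have := rpow_tangent_le hu (hu.trans huv) (p := α - 1) (by linarith)
    rw [show α - 1 - 1 = α - 2 by ring] at this
    linarith
  let φ : ℝ → ℝ := fun s => (S + D) * (kernelInt α x u s - (s - u) * w) -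
    (powPrim α x s - powPrim α x u) + w * (s ^ (α - 1) - u ^ (α - 1))
  have hcont : ContinuousOn φ (Icc u v) := by
    have c1 : ContinuousOn (fun s : ℝ => s ^ (α - 1)) (Icc u v) := fun s hs =>
      (Real.continuousAt_rpow_const s (α - 1)
        (Or.inl (hu.trans_le hs.1).ne')).continuousWithinAt
    have c2 : ContinuousOn (fun s : ℝ => (x - s) ^ (1 - α)) (Icc u v) :=
      (Continuous.rpow_const (by fun_prop) fun _ => Or.inr (by linarith)).continuousOn
    have c3 : ContinuousOn (kernelInt α x u) (Icc u v) :=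
      (continuousOn_const.sub c2).div_const _
    have c4 : ContinuousOn (powPrim α x) (Icc u v) := (c1.mul c2).div_const _
    fun_prop
  have hderiv : ∀ s ∈ interior (Icc u v),
      HasDerivAt φ ((S - (α - 1) * s ^ (α - 2) + D) * ((x - s) ^ (-α) - w)) s := by
    intro s hs
    rw [interior_Icc] at hs
    have hs0 : 0 < s := hu.trans hs.1
    have hsx : s < x := hs.2.trans_le hvx
    have h1 : HasDerivAt (fun y : ℝ => y ^ (α - 1)) (1 * (α - 1) * s ^ (α - 1 - 1)) s :=
      (hasDerivAt_id s).rpow_const (Or.inl hs0.ne')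
    refine ((((hasDerivAt_kernelInt hα1 hsx).sub
      (((hasDerivAt_id s).sub_const u).mul_const w)).const_mul (S + D)).sub
      ((hasDerivAt_powPrim hs0 hsx).sub_const _) |>.add
      ((h1.sub_const (u ^ (α - 1))).const_mul w)).congr_deriv ?_
    rw [show α - 1 - 1 = α - 2 by ring]
    ring
  have hmono : MonotoneOn φ (Icc u v) := by
    refine monotoneOn_of_deriv_nonneg (convex_Icc u v) hcont
      (fun s hs => (hderiv s hs).differentiableAt.differentiableWithinAt) fun s hs => ?_
    rw [(hderiv s hs).deriv]
    rw [interior_Icc] at hs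
    have hs0 : 0 < s := hu.trans hs.1
    have hsx : s < x := hs.2.trans_le hvx
    have h1 : v ^ (α - 2) ≤ s ^ (α - 2) :=
      Real.rpow_le_rpow_of_nonpos hs0 hs.2.le (by linarith)
    have h2 : w ≤ (x - s) ^ (-α) :=
      Real.rpow_le_rpow_of_nonpos (by linarith) (by linarith [hs.1]) (by linarith)
    refine mul_nonneg ?_ (sub_nonneg.2 h2)
    rw [hD]
    nlinarith [mul_le_mul_of_nonneg_left h1 (show 0 ≤ 1 - α by linarith)]
  have hfin := hmono (left_mem_Icc.2 huv.le) (right_mem_Icc.2 huv.le) huv.le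
  have hk : kernelInt α x u u = 0 := by simp [kernelInt]
  simp only [φ, hk, sub_self, zero_mul, mul_zero, add_zero] at hfin
  have hSv : v ^ (α - 1) - u ^ (α - 1) = S * (v - u) := by
    rw [hS, div_mul_cancel₀ _ hvu.ne']
  rw [hSv] at hfin ⊢
  rw [show S * (v - u) * (kernelInt α x u v / (v - u)) = S * kernelInt α x u v by
    field_simp]
  linarith

theorem rpow_le_two_pow_mul {x y p : ℝ} (k : ℕ) (hx : 0 < x) (hy : x / 2 ≤ y) (hp : p ≤ 0)
    (hk : -(k : ℝ) ≤ p) : y ^ p ≤ 2 ^ k * x ^ p := by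
  calc y ^ p ≤ (x / 2) ^ p := Real.rpow_le_rpow_of_nonpos (by linarith) hy hp
    _ = 2 ^ (-p) * x ^ p := by
      rw [Real.div_rpow hx.le (by norm_num), Real.rpow_neg (by norm_num)]; ring
    _ ≤ 2 ^ (k : ℝ) * x ^ p := by
      gcongr
      · norm_num
      · linarith
    _ = _ := by rw [Real.rpow_natCast]

theorem slope_increment_le {α u v : ℝ} (hα0 : 0 < α) (hα1 : α < 1) (hu : 0 < u) (huv : u < v)
    (hh : v / 2 ≤ u) :
    (1 - α) * (u ^ (α - 2) - v ^ (α - 2)) ≤ 16 * (v - u) * v ^ (α - 3) := by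
  have h1 := rpow_tangent_le hu (hu.trans huv) (p := α - 2) (by linarith)
  rw [show α - 2 - 1 = α - 3 by ring] at h1
  have h2 := rpow_le_two_pow_mul (p := α - 3) 3 (hu.trans huv) hh (by linarith)
    (by push_cast; linarith)
  have h3 : 0 ≤ (v - u) * u ^ (α - 3) :=
    mul_nonneg (by linarith) (Real.rpow_pos_of_pos hu _).le
  calc (1 - α) * (u ^ (α - 2) - v ^ (α - 2))
      ≤ (1 - α) * ((2 - α) * ((v - u) * u ^ (α - 3))) := by
        refine mul_le_mul_of_nonneg_left ?_ (by linarith)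
        linarith
    _ ≤ 2 * ((v - u) * u ^ (α - 3)) := by
        rw [← mul_assoc]
        exact mul_le_mul_of_nonneg_right (by nlinarith) h3
    _ ≤ 2 * ((v - u) * (2 ^ 3 * v ^ (α - 3))) := by
        have : 0 ≤ v - u := by linarith
        gcongr
    _ = _ := by ring

theorem interval_error_far {α κ c x u v : ℝ} (hα0 : 0 < α) (hα1 : α < 1)
    (hρ : 0 < 2 * κ - α) (hu : 0 < u) (huv : u < v) (hvx : v ≤ x / 2)
    (hh : v / 2 ≤ u) (hstep : v - u ≤ c * v ^ (1 - κ)) :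
    (1 - α) * (u ^ (α - 2) - v ^ (α - 2)) *
        (kernelInt α x u v - (v - u) * (x - u) ^ (-α)) ≤
      64 * c ^ 2 * x ^ (-α - 1) / (2 * κ - α) * (u ^ (-(2 * κ - α)) - v ^ (-(2 * κ - α))) := by
  have hv : 0 < v := hu.trans huv
  have hx : 0 < x := by linarith
  have hvu : 0 < v - u := sub_pos.2 huv
  have hK : kernelInt α x u v - (v - u) * (x - u) ^ (-α) ≤ 4 * (v - u) ^ 2 * x ^ (-α - 1) := by
    have h1 := kernelInt_le hα0 hα1 (x := x) (u := u) (v := v) (by linarith) (by linarith)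
    have h2 := rpow_tangent_le (x := x - v) (y := x - u) (p := -α) (by linarith) (by linarith)
      (by linarith)
    have h3 := rpow_le_two_pow_mul (p := -α - 1) (y := x - v) 2 hx (by linarith) (by linarith)
      (by push_cast; linarith)
    have h4 : 0 ≤ (v - u) * (x - v) ^ (-α - 1) :=
      mul_nonneg hvu.le (Real.rpow_nonneg (by linarith) _)
    calc _ ≤ (v - u) * ((x - v) ^ (-α) - (x - u) ^ (-α)) := by linarith
      _ ≤ (v - u) * (α * ((v - u) * (x - v) ^ (-α - 1))) := by
        gcongr
        linarith
      _ ≤ (v - u) * (1 * ((v - u) * (2 ^ 2 * x ^ (-α - 1)))) := by gcongr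
      _ = _ := by ring
  have hK0 : 0 ≤ kernelInt α x u v - (v - u) * (x - u) ^ (-α) :=
    sub_nonneg.2 (le_kernelInt hα0 hα1 (by linarith) (by linarith))
  have hsq : (v - u) ^ 2 ≤ c ^ 2 * v ^ (2 - 2 * κ) := by
    calc (v - u) ^ 2 ≤ (c * v ^ (1 - κ)) ^ 2 := by gcongr
      _ = c ^ 2 * v ^ (2 - 2 * κ) := by
        rw [mul_pow, ← Real.rpow_mul_natCast hv.le]; congr 2; push_cast; ring
  have hQ := rpow_tangent_le hv hu (p := -(2 * κ - α)) (by linarith)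
  have hxp := Real.rpow_pos_of_pos hx (-α - 1)
  have hvp := Real.rpow_pos_of_pos hv (α - 3)
  calc _ ≤ 16 * (v - u) * v ^ (α - 3) * (4 * (v - u) ^ 2 * x ^ (-α - 1)) :=
        mul_le_mul (slope_increment_le hα0 hα1 hu huv hh) hK hK0 (by positivity)
    _ ≤ 16 * (v - u) * v ^ (α - 3) * (4 * (c ^ 2 * v ^ (2 - 2 * κ)) * x ^ (-α - 1)) := by
        gcongr
    _ = 64 * c ^ 2 * x ^ (-α - 1) / (2 * κ - α) *
          ((2 * κ - α) * (v - u) * (v ^ (α - 3) * v ^ (2 - 2 * κ))) := by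
        field_simp
        ring
    _ ≤ _ := by
        refine mul_le_mul_of_nonneg_left ?_ (by positivity)
        rw [← Real.rpow_add hv, show α - 3 + (2 - 2 * κ) = -(2 * κ - α) - 1 by ring]
        linarith

/-- The integral of `(x - ·) ^ (-α)` minus its translate by `η`, up to a constant. -/
noncomputable def shiftPrim (α x η s : ℝ) : ℝ :=
  ((x + η - s) ^ (1 - α) - (x - s) ^ (1 - α)) / (1 - α)

theorem kernelInt_sub_le_shiftPrim {α x η u v : ℝ} (hα0 : 0 < α) (hα1 : α < 1)
    (huv : u < v) (hvx : v ≤ x) (hη : v - u ≤ η) :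
    kernelInt α x u v - (v - u) * (x - u) ^ (-α) ≤ shiftPrim α x η v - shiftPrim α x η u := by
  have h1 := kernelInt_le hα0 hα1 (x := x + η) (u := u) (v := v) (by linarith) (by linarith)
  have h2 : (x + η - v) ^ (-α) ≤ (x - u) ^ (-α) :=
    Real.rpow_le_rpow_of_nonpos (by linarith) (by linarith) (by linarith)
  have h3 : shiftPrim α x η v - shiftPrim α x η u =
      kernelInt α x u v - kernelInt α (x + η) u v := by
    rw [shiftPrim, shiftPrim, kernelInt, kernelInt]; ring
  rw [h3]
  nlinarith

theorem interval_error_near {α κ c x u v : ℝ} (hα0 : 0 < α) (hα1 : α < 1) (hκ : κ ≤ 1)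
    (hc : 0 ≤ c) (hu : 0 < u) (huv : u < v) (hvx : v ≤ x) (hxv : x / 2 ≤ v)
    (hh : v / 2 ≤ u) (hstep : v - u ≤ c * v ^ (1 - κ)) :
    (1 - α) * (u ^ (α - 2) - v ^ (α - 2)) *
        (kernelInt α x u v - (v - u) * (x - u) ^ (-α)) ≤
      128 * (c * x ^ (1 - κ)) * x ^ (α - 3) *
        (shiftPrim α x (c * x ^ (1 - κ)) v - shiftPrim α x (c * x ^ (1 - κ)) u) := by
  have hv : 0 < v := hu.trans huv
  have hx : 0 < x := by linarith
  have hη : v - u ≤ c * x ^ (1 - κ) := hstep.trans (by gcongr)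
  have hK0 : 0 ≤ kernelInt α x u v - (v - u) * (x - u) ^ (-α) :=
    sub_nonneg.2 (le_kernelInt hα0 hα1 (by linarith) (by linarith))
  have hvp := rpow_le_two_pow_mul (p := α - 3) 3 hx hxv (by linarith) (by push_cast; linarith)
  have hD : (1 - α) * (u ^ (α - 2) - v ^ (α - 2)) ≤
      128 * (c * x ^ (1 - κ)) * x ^ (α - 3) := by
    calc _ ≤ 16 * (v - u) * v ^ (α - 3) := slope_increment_le hα0 hα1 hu huv hh
      _ ≤ 16 * (c * x ^ (1 - κ)) * (2 ^ 3 * x ^ (α - 3)) := by gcongr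
      _ = _ := by ring
  exact mul_le_mul hD (kernelInt_sub_le_shiftPrim hα0 hα1 huv hvx hη) hK0 (by positivity)

/-- The barrier `min (s * a ^ (α - 2)) (s ^ (α - 1))` at the mesh nodes, where `a = t p`. -/
noncomputable def barrier (α : ℝ) (t : ℕ → ℝ) (p j : ℕ) : ℝ :=
  if j ≤ p then t j * t p ^ (α - 2) else t j ^ (α - 1)

theorem barrier_of_le {α : ℝ} {t : ℕ → ℝ} {p j : ℕ} (h : 0 < t j) (hp : p ≤ j) :
    barrier α t p j = t j ^ (α - 1) := by
  rw [barrier]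
  split_ifs with hj
  · obtain rfl : j = p := le_antisymm hj hp
    rw [mul_comm, ← Real.rpow_add_one h.ne']
    congr 1; ring
  · rfl

theorem l1Sum_barrier_of_le {α : ℝ} {t : ℕ → ℝ} {p n : ℕ} (ht0 : t 0 = 0)
    (ht : StrictMonoOn t (Iic p)) (x : ℝ) (hn : n ≤ p) :
    l1Sum α t (barrier α t p) x n = t p ^ (α - 2) * kernelInt α x 0 (t n) := by
  induction n with
  | zero => simp [l1Sum, kernelInt, ht0]
  | succ n ih =>
    have hlt : t n < t (n + 1) := ht (mem_Iic.2 (by omega)) (mem_Iic.2 hn) (by omega)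
    rw [l1Sum_succ, ih (by omega), barrier, if_pos hn, barrier, if_pos (by omega), ← sub_mul,
      mul_right_comm, mul_div_cancel₀ _ (sub_pos.2 hlt).ne', kernelInt, kernelInt, kernelInt]
    ring

theorem l1Sum_barrier_ge {α κ c x : ℝ} {t : ℕ → ℝ} {p n : ℕ} (hα0 : 0 < α) (hα1 : α < 1)
    (hκ : κ ≤ 1) (hρ : 0 < 2 * κ - α) (hc : 0 ≤ c) (hpn : p ≤ n) (hp : 0 < t p)
    (ht : StrictMonoOn t (Iic n)) (hnx : t n ≤ x)
    (hstep : ∀ i, p ≤ i → i < n →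
      t (i + 1) / 2 ≤ t i ∧ t (i + 1) - t i ≤ c * t (i + 1) ^ (1 - κ)) :
    l1Sum α t (barrier α t p) x p + (powPrim α x (t n) - powPrim α x (t p)) -
        64 * c ^ 2 * x ^ (-α - 1) / (2 * κ - α) *
          (t p ^ (-(2 * κ - α)) - t n ^ (-(2 * κ - α))) -
        128 * (c * x ^ (1 - κ)) * x ^ (α - 3) *
          (shiftPrim α x (c * x ^ (1 - κ)) (t n) - shiftPrim α x (c * x ^ (1 - κ)) (t p)) ≤
      l1Sum α t (barrier α t p) x n := by
  induction n, hpn using Nat.le_induction with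
  | base => simp
  | succ n hpn ih =>
    have hlt : t n < t (n + 1) := ht (mem_Iic.2 (by omega)) (mem_Iic.2 le_rfl) (by omega)
    have hpos : 0 < t n := hp.trans_le
      (ht.monotoneOn (mem_Iic.2 (by omega)) (mem_Iic.2 (by omega)) hpn)
    have hx : 0 < x := by linarith
    have hih := ih (ht.mono (Iic_subset_Iic.2 (by omega))) (by linarith)
      (fun i h1 h2 => hstep i h1 (by omega))
    obtain ⟨hh, hs⟩ := hstep n hpn (by omega)
    rw [l1Sum_succ, barrier_of_le (hpos.trans hlt) (by omega), barrier_of_le hpos hpn]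
    have hI := interp_ge_powPrim hα0 hα1 hpos hlt hnx
    have hQ : 0 ≤ 64 * c ^ 2 * x ^ (-α - 1) / (2 * κ - α) *
        (t n ^ (-(2 * κ - α)) - t (n + 1) ^ (-(2 * κ - α))) := by
      have := Real.rpow_le_rpow_of_nonpos hpos hlt.le (z := -(2 * κ - α)) (by linarith)
      exact mul_nonneg (by positivity) (by linarith)
    have hη : t (n + 1) - t n ≤ c * x ^ (1 - κ) := hs.trans (by gcongr; linarith)
    have hP : 0 ≤ 128 * (c * x ^ (1 - κ)) * x ^ (α - 3) *
        (shiftPrim α x (c * x ^ (1 - κ)) (t (n + 1)) - shiftPrim α x (c * x ^ (1 - κ)) (t n)) := by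
      refine mul_nonneg (by positivity) (le_trans ?_
        (kernelInt_sub_le_shiftPrim hα0 hα1 hlt hnx hη))
      exact sub_nonneg.2 (le_kernelInt hα0 hα1 (by linarith) (by linarith))
    rcases le_total (t (n + 1)) (x / 2) with h | h
    · have := interval_error_far hα0 hα1 hρ hpos hlt h hh hs
      linarith
    · have := interval_error_near hα0 hα1 hκ hc hpos hlt hnx h hh hs
      linarith

theorem mul_rpow_le_kernelInt_sub_powPrim {α a x : ℝ} (hα0 : 0 < α) (hα1 : α < 1) (ha : 0 < a)
    (hax : a ≤ x) :
    (1 - α) * (a ^ α * x ^ (-α - 1)) ≤ a ^ (α - 2) * kernelInt α x 0 a - powPrim α x a := by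
  have hx : 0 < x := ha.trans_le hax
  have h1 := le_kernelInt hα0 hα1 (x := x) (u := 0) (v := a) hx hax
  have h2 := rpow_le_tangent (x := x) (y := x - a) (q := 1 - α) hx (by linarith)
    (by linarith) (by linarith)
  rw [show 1 - α - 1 = -α by ring] at h2
  rw [sub_zero, sub_zero] at h1
  have e0 : x ^ (1 - α) = x ^ (-α) * x := by
    rw [← Real.rpow_add_one hx.ne']; congr 1; ring
  have e1 : a ^ α = a ^ (α - 2) * a ^ 2 := by
    rw [← Real.rpow_natCast a 2, ← Real.rpow_add ha]; congr 1; push_cast; ring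
  have e2 : a ^ (α - 1) = a ^ (α - 2) * a := by
    rw [← Real.rpow_add_one ha.ne']; congr 1; ring
  have e3 : x ^ (-α - 1) = x ^ (-α) / x := Real.rpow_sub_one hx.ne' _
  have hA := Real.rpow_pos_of_pos ha (α - 2)
  have h3 : a ^ (α - 2) * a / x * (x - a) ^ (1 - α) ≤
      a ^ (α - 2) * a / x * (x ^ (-α) * x + (1 - α) * (x - a - x) * x ^ (-α)) := by
    rw [← e0]; gcongr
  have h4 := mul_le_mul_of_nonneg_left h1 hA.le
  calc _ = a ^ (α - 2) * (a * x ^ (-α)) -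
        a ^ (α - 2) * a / x * (x ^ (-α) * x + (1 - α) * (x - a - x) * x ^ (-α)) := by
        rw [e1, e3]; field_simp; ring
    _ ≤ a ^ (α - 2) * kernelInt α x 0 a - a ^ (α - 2) * a / x * (x - a) ^ (1 - α) := by linarith
    _ = _ := by rw [powPrim, e2]; ring

theorem rpow_mul_rpow_one_sub {τ x κ : ℝ} (hτ : 0 < τ) (hx : 0 < x) :
    τ ^ κ * x ^ (1 - κ) = (τ / x) ^ κ * x := by
  rw [Real.div_rpow hτ.le hx.le, Real.rpow_sub hx, Real.rpow_one]
  ring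

theorem far_error_eq {α κ C τ a x : ℝ} (hτ : 0 < τ) (ha : 0 < a) :
    64 * (C * τ ^ κ) ^ 2 * x ^ (-α - 1) / (2 * κ - α) * a ^ (-(2 * κ - α)) =
      64 * C ^ 2 / (2 * κ - α) * ((τ / a) ^ κ) ^ 2 * (a ^ α * x ^ (-α - 1)) := by
  have e : a ^ (-(2 * κ - α)) = a ^ α / (a ^ κ) ^ 2 := by
    rw [← Real.rpow_mul_natCast ha.le, ← Real.rpow_sub ha]; congr 1; push_cast; ring
  rw [e, Real.div_rpow hτ.le ha.le]
  ring

theorem near_error_le {α κ C τ a x : ℝ} (hα1 : α < 1) (hC : 0 < C)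
    (hκα : α ≤ κ * (2 - α)) (hτ : 0 < τ) (ha : 0 < a) (hτx : τ ≤ x) :
    128 * (C * τ ^ κ * x ^ (1 - κ)) * x ^ (α - 3) *
        ((C * τ ^ κ * x ^ (1 - κ)) ^ (1 - α) / (1 - α)) ≤
      128 * C ^ (2 - α) / (1 - α) * (τ / a) ^ α * (a ^ α * x ^ (-α - 1)) := by
  have hx : 0 < x := hτ.trans_le hτx
  have hα' : 0 < 1 - α := by linarith
  rw [mul_assoc C, rpow_mul_rpow_one_sub hτ hx]
  set e := τ / x with he
  have he0 : 0 < e := div_pos hτ hx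
  have he1 : e ≤ 1 := (div_le_one hx).2 hτx
  have hη : (C * (e ^ κ * x)) * (C * (e ^ κ * x)) ^ (1 - α) =
      C ^ (2 - α) * (e ^ (κ * (2 - α)) * x ^ (2 - α)) := by
    rw [mul_comm, ← Real.rpow_add_one (by positivity), show 1 - α + 1 = 2 - α by ring,
      Real.mul_rpow hC.le (by positivity), Real.mul_rpow (by positivity) hx.le,
      ← Real.rpow_mul he0.le]
  have h1 : e ^ (κ * (2 - α)) ≤ e ^ α := Real.rpow_le_rpow_of_exponent_ge he0 he1 hκα
  have h2 : x ^ (2 - α) * x ^ (α - 3) = x ^ (-1 : ℝ) := by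
    rw [← Real.rpow_add hx]; congr 1; ring
  have h3 : x ^ (-α - 1) = x ^ (-1 : ℝ) / x ^ α := by
    rw [← Real.rpow_sub hx]; congr 1; ring
  calc _ = 128 / (1 - α) * ((C * (e ^ κ * x)) * (C * (e ^ κ * x)) ^ (1 - α)) * x ^ (α - 3) := by
        ring
    _ = 128 * C ^ (2 - α) / (1 - α) * e ^ (κ * (2 - α)) * (x ^ (2 - α) * x ^ (α - 3)) := by
        rw [hη]; ring
    _ ≤ 128 * C ^ (2 - α) / (1 - α) * e ^ α * (x ^ (2 - α) * x ^ (α - 3)) := by gcongr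
    _ = _ := by
        rw [h2, h3, he, Real.div_rpow hτ.le hx.le, Real.div_rpow hτ.le ha.le]
        have := (Real.rpow_pos_of_pos ha α).ne'
        field_simp

theorem exists_ratio_threshold {α κ C ρ : ℝ} (hα0 : 0 < α) (hα1 : α < 1) (hκ : 0 < κ) :
    ∃ K : ℝ, 1 ≤ K ∧ ∀ e : ℝ, 0 < e → K * e ≤ 1 → C * e ^ κ ≤ 1 / 2 ∧
      64 * C ^ 2 / ρ * (e ^ κ) ^ 2 ≤ (1 - α) / 4 ∧
      128 * C ^ (2 - α) / (1 - α) * e ^ α ≤ (1 - α) / 4 := by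
  have hcκ : ContinuousAt (fun e : ℝ => e ^ κ) 0 := Real.continuousAt_rpow_const _ _ (Or.inr hκ.le)
  have hcα : ContinuousAt (fun e : ℝ => e ^ α) 0 :=
    Real.continuousAt_rpow_const _ _ (Or.inr hα0.le)
  have h0κ : (0 : ℝ) ^ κ = 0 := Real.zero_rpow hκ.ne'
  have h0α : (0 : ℝ) ^ α = 0 := Real.zero_rpow hα0.ne'
  have h1 : ∀ᶠ e : ℝ in nhds 0, C * e ^ κ < 1 / 2 :=
    (hcκ.const_mul C).eventually_lt_const (by simp [h0κ])
  have h2 : ∀ᶠ e : ℝ in nhds 0, 64 * C ^ 2 / ρ * (e ^ κ) ^ 2 < (1 - α) / 4 :=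
    ((hcκ.pow 2).const_mul _).eventually_lt_const (by simp [h0κ]; linarith)
  have h3 : ∀ᶠ e : ℝ in nhds 0, 128 * C ^ (2 - α) / (1 - α) * e ^ α < (1 - α) / 4 :=
    (hcα.const_mul _).eventually_lt_const (by simp [h0α]; linarith)
  obtain ⟨ε, hε, hball⟩ := Metric.eventually_nhds_iff.1 (h1.and (h2.and h3))
  refine ⟨max 1 (2 / ε), le_max_left _ _, fun e he hKe => ?_⟩
  have hlt : e < ε := by
    have : 2 / ε * e ≤ 1 := (mul_le_mul_of_nonneg_right (le_max_right _ _) he.le).trans hKe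
    rw [div_mul_eq_mul_div, div_le_one hε] at this
    linarith
  have := hball (y := e) (by rwa [Real.dist_eq, sub_zero, abs_of_pos he])
  exact ⟨this.1.le, this.2.1.le, this.2.2.le⟩

theorem l1Sum_barrier_lower {α κ C τ : ℝ} {t : ℕ → ℝ} {p m : ℕ} (hα0 : 0 < α) (hα1 : α < 1)
    (hκ1 : κ ≤ 1) (hκ0 : 0 < κ) (hρ : 0 < 2 * κ - α) (hκα : α ≤ κ * (2 - α)) (hC : 0 < C)
    (hτ : 0 < τ) (ht0 : t 0 = 0) (ht : StrictMonoOn t (Iic m)) (hpm : p ≤ m) (hτp : τ ≤ t p)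
    (hstep : ∀ i < m, t (i + 1) - t i ≤ C * (τ ^ κ * t (i + 1) ^ (1 - κ)))
    (h1 : C * (τ / t p) ^ κ ≤ 1 / 2)
    (h2 : 64 * C ^ 2 / (2 * κ - α) * ((τ / t p) ^ κ) ^ 2 ≤ (1 - α) / 4)
    (h3 : 128 * C ^ (2 - α) / (1 - α) * (τ / t p) ^ α ≤ (1 - α) / 4) :
    (1 - α) / 2 * (t p ^ α * t m ^ (-α - 1)) ≤ l1Sum α t (barrier α t p) (t m) m := by
  have hp : 0 < t p := hτ.trans_le hτp
  have hle : ∀ i, p ≤ i → i ≤ m → t p ≤ t i := fun i h h' =>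
    ht.monotoneOn (mem_Iic.2 (by omega)) (mem_Iic.2 h') h
  have hpx : t p ≤ t m := hle m hpm le_rfl
  have hx : 0 < t m := hp.trans_le hpx
  have key := l1Sum_barrier_ge (x := t m) (c := C * τ ^ κ) hα0 hα1 hκ1 hρ (by positivity) hpm hp ht
    le_rfl (fun i hi him => by
      have hs := hstep i him
      refine ⟨?_, by rwa [mul_assoc]⟩
      have hi1 : t p ≤ t (i + 1) := hle (i + 1) (by omega) (by omega)
      have hi0 : 0 < t (i + 1) := hp.trans_le hi1
      rw [rpow_mul_rpow_one_sub hτ hi0] at hs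
      have : C * (τ / t (i + 1)) ^ κ ≤ C * (τ / t p) ^ κ := by gcongr
      nlinarith [mul_le_mul_of_nonneg_right (this.trans h1) hi0.le])
  rw [l1Sum_barrier_of_le ht0 (ht.mono (Iic_subset_Iic.2 hpm)) _ le_rfl] at key
  have hmain := mul_rpow_le_kernelInt_sub_powPrim hα0 hα1 hp hpx
  have hH : powPrim α (t m) (t m) = 0 := by
    rw [powPrim, sub_self, Real.zero_rpow (by linarith)]; simp
  have hZ : 0 ≤ t p ^ α * t m ^ (-α - 1) := by positivity
  have hfar : 64 * (C * τ ^ κ) ^ 2 * t m ^ (-α - 1) / (2 * κ - α) *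
      (t p ^ (-(2 * κ - α)) - t m ^ (-(2 * κ - α))) ≤
      (1 - α) / 4 * (t p ^ α * t m ^ (-α - 1)) := by
    calc _ ≤ 64 * (C * τ ^ κ) ^ 2 * t m ^ (-α - 1) / (2 * κ - α) * t p ^ (-(2 * κ - α)) := by
          refine mul_le_mul_of_nonneg_left ?_ (by positivity)
          linarith [Real.rpow_pos_of_pos hx (-(2 * κ - α))]
      _ ≤ _ := by
          rw [far_error_eq hτ hp]
          exact mul_le_mul_of_nonneg_right h2 hZ
  have hnear : 128 * (C * τ ^ κ * t m ^ (1 - κ)) * t m ^ (α - 3) *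
      (shiftPrim α (t m) (C * τ ^ κ * t m ^ (1 - κ)) (t m) -
        shiftPrim α (t m) (C * τ ^ κ * t m ^ (1 - κ)) (t p)) ≤
      (1 - α) / 4 * (t p ^ α * t m ^ (-α - 1)) := by
    have hη : 0 ≤ C * τ ^ κ * t m ^ (1 - κ) := by positivity
    have hs1 : shiftPrim α (t m) (C * τ ^ κ * t m ^ (1 - κ)) (t m) =
        (C * τ ^ κ * t m ^ (1 - κ)) ^ (1 - α) / (1 - α) := by
      rw [shiftPrim, sub_self, Real.zero_rpow (by linarith), add_sub_cancel_left, sub_zero]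
    have hs2 : 0 ≤ shiftPrim α (t m) (C * τ ^ κ * t m ^ (1 - κ)) (t p) := by
      refine div_nonneg (sub_nonneg.2 ?_) (by linarith)
      exact Real.rpow_le_rpow (by linarith) (by linarith) (by linarith)
    calc _ ≤ 128 * (C * τ ^ κ * t m ^ (1 - κ)) * t m ^ (α - 3) *
          ((C * τ ^ κ * t m ^ (1 - κ)) ^ (1 - α) / (1 - α)) := by
          refine mul_le_mul_of_nonneg_left ?_ (by positivity)
          linarith
      _ ≤ _ := near_error_le hα1 hC hκα hτ hp (hτp.trans hpx)
      _ ≤ _ := mul_le_mul_of_nonneg_right h3 hZ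
  rw [hH] at key
  linarith

/-- The weights with which the barriers are superposed. -/
noncomputable def weight (α γ : ℝ) (t : ℕ → ℝ) (p₀ p : ℕ) : ℝ :=
  if p = p₀ then t p₀ ^ (-γ) else (t p ^ (α - γ) - t (p - 1) ^ (α - γ)) * t p ^ (-α)

theorem weight_succ {α γ : ℝ} {t : ℕ → ℝ} {p₀ n : ℕ} (hn : p₀ ≤ n) :
    weight α γ t p₀ (n + 1) = (t (n + 1) ^ (α - γ) - t n ^ (α - γ)) * t (n + 1) ^ (-α) := by
  rw [weight, if_neg (by omega), Nat.add_sub_cancel]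

theorem weight_nonneg {α γ : ℝ} {t : ℕ → ℝ} {p₀ p m : ℕ} (hγ : γ < α)
    (hpos : 0 < t p₀) (ht : StrictMonoOn t (Iic m)) (hp : p₀ ≤ p) (hpm : p ≤ m) :
    0 ≤ weight α γ t p₀ p := by
  have hle : ∀ i, p₀ ≤ i → i ≤ m → t p₀ ≤ t i := fun i h h' =>
    ht.monotoneOn (mem_Iic.2 (by omega)) (mem_Iic.2 h') h
  rw [weight]
  split_ifs with h
  · positivity
  · have h1 := hle (p - 1) (by omega) (by omega)
    have h2 := hle p hp hpm
    have h3 : t (p - 1) ≤ t p :=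
      ht.monotoneOn (mem_Iic.2 (by omega)) (mem_Iic.2 hpm) (by omega)
    exact mul_nonneg (sub_nonneg.2 (Real.rpow_le_rpow (by linarith) h3 (by linarith)))
      (Real.rpow_nonneg (by linarith) _)

theorem sum_weight_mul_rpow {α γ : ℝ} {t : ℕ → ℝ} {p₀ n : ℕ} (hpos : ∀ i, p₀ ≤ i → i ≤ n → 0 < t i)
    (hn : p₀ ≤ n) :
    ∑ p ∈ Finset.Icc p₀ n, weight α γ t p₀ p * t p ^ α = t n ^ (α - γ) := by
  induction n, hn using Nat.le_induction with
  | base =>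
    rw [Finset.Icc_self, Finset.sum_singleton, weight, if_pos rfl,
      ← Real.rpow_add (hpos _ le_rfl le_rfl)]
    congr 1; ring
  | succ n hn ih =>
    have h := hpos (n + 1) (by omega) le_rfl
    rw [Finset.sum_Icc_succ_top (by omega), ih fun i h1 h2 => hpos i h1 (by omega),
      weight_succ hn, mul_assoc, ← Real.rpow_add h, neg_add_cancel, Real.rpow_zero]
    ring

theorem sum_weight_le {α γ : ℝ} {t Φ : ℕ → ℝ} {p₀ n : ℕ} (hn : p₀ ≤ n)
    (hΦ : ∀ i, p₀ ≤ i → i < n →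
      (t (i + 1) ^ (α - γ) - t i ^ (α - γ)) * t (i + 1) ^ (-α) ≤ Φ (i + 1) - Φ i) :
    ∑ p ∈ Finset.Icc p₀ n, weight α γ t p₀ p ≤ t p₀ ^ (-γ) + (Φ n - Φ p₀) := by
  induction n, hn using Nat.le_induction with
  | base => simp [weight]
  | succ n hn ih =>
    rw [Finset.sum_Icc_succ_top (by omega), weight_succ hn]
    have h1 := ih fun i h1 h2 => hΦ i h1 (by omega)
    have h2 := hΦ n hn (by omega)
    linarith

theorem increment_le_rpow {α γ u v : ℝ} (hα0 : 0 < α) (hγ : γ < α) (hγ0 : γ ≠ 0) (hu : 0 < u)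
    (huv : u < v) :
    (v ^ (α - γ) - u ^ (α - γ)) * v ^ (-α) ≤ (α - γ) / γ * (u ^ (-γ) - v ^ (-γ)) := by
  have hv := hu.trans huv
  have hy : 0 < (u / v) ^ (-γ) := by positivity
  have hB : 1 + -((α - γ) / γ) * ((u / v) ^ (-γ) - 1) ≤
      ((u / v) ^ (-γ)) ^ (-((α - γ) / γ)) := by
    rcases hγ0.lt_or_gt with h | h
    · have hq : 1 ≤ -((α - γ) / γ) := by
        rw [← div_neg, le_div_iff₀ (by linarith)]; linarith
      have := one_add_mul_self_le_rpow_one_add (s := (u / v) ^ (-γ) - 1) (by linarith) hq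
      rwa [add_sub_cancel] at this
    · exact one_add_mul_sub_one_le_rpow hy
        (neg_nonpos.2 (div_nonneg (by linarith) h.le))
  rw [← Real.rpow_mul (by positivity), show -γ * -((α - γ) / γ) = α - γ by field_simp,
    Real.div_rpow hu.le hv.le, Real.div_rpow hu.le hv.le] at hB
  have e : v ^ (α - γ) * v ^ (-α) = v ^ (-γ) := by rw [← Real.rpow_add hv]; congr 1; ring
  have hvγ := Real.rpow_pos_of_pos hv (-γ)
  have hvα := Real.rpow_pos_of_pos hv (α - γ)
  have h := mul_le_mul_of_nonneg_right hB hvγ.le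
  have e2 : u ^ (α - γ) / v ^ (α - γ) * v ^ (-γ) = u ^ (α - γ) * v ^ (-α) := by
    rw [← e]; field_simp
  have e3 : (1 + -((α - γ) / γ) * (u ^ (-γ) / v ^ (-γ) - 1)) * v ^ (-γ) =
      v ^ (-γ) - (α - γ) / γ * (u ^ (-γ) - v ^ (-γ)) := by
    field_simp
    ring
  rw [e2, e3] at h
  rw [sub_mul, e]
  linarith

theorem increment_le_log {α u v : ℝ} (hu : 0 < u) (huv : u < v) :
    (v ^ α - u ^ α) * v ^ (-α) ≤ α * (Real.log v - Real.log u) := by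
  have hv := hu.trans huv
  have h := Real.add_one_le_exp (Real.log (u / v) * α)
  rw [← Real.rpow_def_of_pos (by positivity), Real.log_div hu.ne' hv.ne',
    Real.div_rpow hu.le hv.le] at h
  have hvα := Real.rpow_pos_of_pos hv α
  rw [Real.rpow_neg hv.le, sub_mul, mul_inv_cancel₀ hvα.ne', ← div_eq_mul_inv]
  linarith

theorem exists_sum_weight_le_Vcal {α γ : ℝ} (hα0 : 0 < α) (hα1 : α < 1) (hγ : γ < α) :
    ∃ C : ℝ, 0 < C ∧ ∀ (t : ℕ → ℝ) (τ : ℝ) (p₀ m : ℕ), 0 < τ → τ ≤ t p₀ → p₀ ≤ m →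
      StrictMonoOn t (Iic m) →
      τ ^ (γ + 1) * (t m ^ (α - 1) * ∑ p ∈ Finset.Icc p₀ m, weight α γ t p₀ p) ≤
        C * Vcal α γ τ (t m) := by
  refine ⟨1 + (α - γ) / |γ|, by have := sub_pos.2 hγ; positivity, fun t τ p₀ m hτ hτp hpm ht => ?_⟩
  have hp := hτ.trans_le hτp
  have hle : ∀ i, p₀ ≤ i → i ≤ m → t p₀ ≤ t i := fun i h h' =>
    ht.monotoneOn (mem_Iic.2 (by omega)) (mem_Iic.2 h') h
  have hpx := hle m hpm le_rfl
  have hx := hp.trans_le hpx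
  have hlt : ∀ i, p₀ ≤ i → i < m → 0 < t i ∧ t i < t (i + 1) := fun i h h' =>
    ⟨hp.trans_le (hle i h h'.le), ht (mem_Iic.2 (by omega)) (mem_Iic.2 (by omega)) (by omega)⟩
  rcases lt_trichotomy γ 0 with h | rfl | h
  · have hs := sum_weight_le (t := t) (α := α) (γ := γ) (Φ := fun i => -((α - γ) / γ) * t i ^ (-γ))
      hpm fun i h1 h2 => by
        have := increment_le_rpow hα0 hγ h.ne (hlt i h1 h2).1 (hlt i h1 h2).2
        linarith
    rw [Vcal, if_neg h.not_gt, if_neg h.ne, abs_of_neg h, div_neg]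
    have hq : 0 < -((α - γ) / γ) := by rw [← div_neg]; exact div_pos (by linarith) (by linarith)
    have h1 : t p₀ ^ (-γ) ≤ t m ^ (-γ) := Real.rpow_le_rpow hp.le hpx (by linarith)
    have h2 := mul_pos hq (Real.rpow_pos_of_pos hp (-γ))
    calc _ ≤ τ ^ (γ + 1) * (t m ^ (α - 1) * ((1 + -((α - γ) / γ)) * t m ^ (-γ))) := by
          gcongr
          linarith
      _ = _ := by
          rw [Real.rpow_add_one hτ.ne', Real.div_rpow hτ.le hx.le, Real.rpow_neg hx.le]
          ring
  · have hs := sum_weight_le (t := t) (α := α) (γ := 0) (Φ := fun i => α * Real.log (t i))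
      hpm fun i h1 h2 => by
        have := increment_le_log (α := α) (hlt i h1 h2).1 (hlt i h1 h2).2
        rw [sub_zero]
        linarith
    rw [Vcal, if_neg (lt_irrefl _), if_pos rfl, abs_zero, div_zero, add_zero, one_mul, zero_add,
      Real.rpow_one, mul_assoc]
    rw [neg_zero, Real.rpow_zero] at hs
    have h1 : Real.log τ ≤ Real.log (t p₀) := Real.log_le_log hτ hτp
    have h2 : Real.log (t p₀) ≤ Real.log (t m) := Real.log_le_log hp hpx
    gcongr
    rw [Real.log_div hx.ne' hτ.ne']
    nlinarith
  · have hs := sum_weight_le (t := t) (α := α) (γ := γ) (Φ := fun i => -((α - γ) / γ) * t i ^ (-γ))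
      hpm fun i h1 h2 => by
        have := increment_le_rpow hα0 hγ h.ne' (hlt i h1 h2).1 (hlt i h1 h2).2
        linarith
    rw [Vcal, if_pos h, abs_of_pos h]
    have hq : 0 < (α - γ) / γ := div_pos (by linarith) h
    have h1 : t p₀ ^ (-γ) ≤ τ ^ (-γ) := Real.rpow_le_rpow_of_nonpos hτ hτp (by linarith)
    have h2 := mul_pos hq (Real.rpow_pos_of_pos hx (-γ))
    have h3 := mul_le_mul_of_nonneg_left h1 hq.le
    calc _ ≤ τ ^ (γ + 1) * (t m ^ (α - 1) * ((1 + (α - γ) / γ) * τ ^ (-γ))) := by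
          gcongr
          linarith
      _ = (1 + (α - γ) / γ) * ((τ ^ (γ + 1) * τ ^ (-γ)) * t m ^ (α - 1)) := by ring
      _ = _ := by
          rw [← Real.rpow_add hτ, show γ + 1 + -γ = 1 by ring, Real.rpow_one]

/-- The first mesh node beyond `K * τ` is still comparable with `τ`. -/
theorem exists_start_node {κ C K τ : ℝ} {t : ℕ → ℝ} {m : ℕ} (hκ0 : 0 < κ) (hC : 0 < C)
    (hK : 1 ≤ K) (hτ : 0 < τ) (hτ1 : t 1 = τ) (hm : 1 ≤ m) (hpos : ∀ i, 1 ≤ i → i ≤ m → 0 < t i)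
    (hstep : ∀ i < m, t (i + 1) - t i ≤ C * (τ ^ κ * t (i + 1) ^ (1 - κ))) :
    ∃ p, 1 ≤ p ∧ p ≤ m ∧ t p ≤ max (2 * K) ((2 * C) ^ (1 / κ)) * τ ∧ (p = m ∨ K * τ ≤ t p) := by
  set L := max (2 * K) ((2 * C) ^ (1 / κ)) with hL
  have hL1 : 2 * K ≤ L := le_max_left _ _
  by_cases hex : ∃ p, 1 ≤ p ∧ p ≤ m ∧ K * τ ≤ t p
  · classical
    obtain ⟨h1, h2, h3⟩ := Nat.find_spec hex
    refine ⟨Nat.find hex, h1, h2, ?_, Or.inr h3⟩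
    have hmin : ∀ i < Nat.find hex, ¬(1 ≤ i ∧ i ≤ m ∧ K * τ ≤ t i) := fun i => Nat.find_min hex
    generalize Nat.find hex = q at *
    by_contra! hlt
    have hq1 : q ≠ 1 := by
      rintro rfl
      nlinarith
    obtain ⟨i, rfl⟩ : ∃ i, q = i + 1 := ⟨q - 1, by omega⟩
    have hti : t i < K * τ := by
      by_contra! h
      exact hmin i (by omega) ⟨by omega, by omega, h⟩
    have hq := hpos (i + 1) h1 h2
    have hs := hstep i (by omega)
    rw [rpow_mul_rpow_one_sub hτ hq] at hs
    have hr : (2 * C) ^ (1 / κ) ≤ t (i + 1) / τ := by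
      rw [le_div_iff₀ hτ]
      exact (mul_le_mul_of_nonneg_right (le_max_right _ _) hτ.le).trans hlt.le
    have hr2 : 2 * C ≤ (t (i + 1) / τ) ^ κ := by
      calc 2 * C = ((2 * C) ^ (1 / κ)) ^ κ := by
            rw [← Real.rpow_mul (by positivity), one_div_mul_cancel hκ0.ne', Real.rpow_one]
        _ ≤ _ := Real.rpow_le_rpow (by positivity) hr hκ0.le
    have hr3 : C * (τ / t (i + 1)) ^ κ ≤ 1 / 2 := by
      rw [← inv_div, Real.inv_rpow (by positivity), ← div_eq_mul_inv, div_le_iff₀ (by positivity)]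
      linarith
    have := mul_le_mul_of_nonneg_right hr3 hq.le
    nlinarith [mul_le_mul_of_nonneg_right hL1 hτ.le]
  · push Not at hex
    refine ⟨m, hm, le_rfl, ?_, Or.inl rfl⟩
    have := hex m hm le_rfl
    nlinarith [mul_le_mul_of_nonneg_right hL1 hτ.le]

theorem Vcal_min {α γ τ x : ℝ} (hα0 : 0 < α) : Vcal α (min γ (α / 2)) τ x = Vcal α γ τ x := by
  rcases le_total γ (α / 2) with h | h
  · rw [min_eq_left h]
  · rw [min_eq_right h, Vcal, Vcal, if_pos (by linarith), if_pos (by linarith)]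

theorem barrier_start_lower {α γ L a s : ℝ} (hα0 : 0 < α) (hα1 : α < 1) (hs : 0 < s)
    (hsa : s ≤ a) (haL : a ≤ L * s) :
    L ^ (-|2 - α + γ|) * s ^ (-γ - 1) ≤ a ^ (-γ) * (a ^ (α - 2) * kernelInt α s 0 s) := by
  have ha := hs.trans_le hsa
  have hK : s ^ (1 - α) ≤ kernelInt α s 0 s := by
    have := le_kernelInt hα0 hα1 (x := s) (u := 0) (v := s) hs le_rfl
    rwa [sub_zero, mul_comm, ← Real.rpow_add_one hs.ne', neg_add_eq_sub] at this
  have hy1 : 1 ≤ a / s := (one_le_div hs).2 hsa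
  have hyL : a / s ≤ L := (div_le_iff₀ hs).2 haL
  have h1 : L ^ (-|2 - α + γ|) ≤ (a / s) ^ (-(2 - α + γ)) :=
    (Real.rpow_le_rpow_of_nonpos (by linarith) hyL (neg_nonpos.2 (abs_nonneg _))).trans
      (Real.rpow_le_rpow_of_exponent_le hy1 (neg_le_neg (le_abs_self _)))
  calc _ ≤ (a / s) ^ (-(2 - α + γ)) * s ^ (-γ - 1) := by gcongr
    _ = a ^ (-γ) * (a ^ (α - 2) * s ^ (1 - α)) := by
      rw [Real.div_rpow ha.le hs.le, div_mul_eq_mul_div, mul_div_assoc, ← Real.rpow_sub hs,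
        ← mul_assoc, ← Real.rpow_add ha]
      congr 2 <;> ring
    _ ≤ _ := by gcongr

theorem l1Sum_weighted_barrier_lower {α γ L : ℝ} {t : ℕ → ℝ} {p₀ m j : ℕ} (hα0 : 0 < α)
    (hα1 : α < 1) (hγ : γ < α) (ht0 : t 0 = 0) (ht : StrictMonoOn t (Iic m)) (hp1 : 1 ≤ p₀)
    (hpm : p₀ ≤ m) (hL : t p₀ ≤ L * t 1)
    (hB : ∀ p n, p₀ ≤ p → p < n → n ≤ m →
      (1 - α) / 2 * (t p ^ α * t n ^ (-α - 1)) ≤ l1Sum α t (barrier α t p) (t n) n)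
    (hj1 : 1 ≤ j) (hjm : j ≤ m) :
    min ((1 - α) / 2) (L ^ (-|2 - α + γ|)) * t j ^ (-γ - 1) ≤
      l1Sum α t (fun j => ∑ p ∈ Finset.Icc p₀ m, weight α γ t p₀ p * barrier α t p j) (t j) j := by
  rw [l1Sum_sum]
  have hle : ∀ i k, i ≤ k → k ≤ m → t i ≤ t k := fun i k h h' =>
    ht.monotoneOn (mem_Iic.2 (by omega)) (mem_Iic.2 h') h
  have hpos : ∀ i, 1 ≤ i → i ≤ m → 0 < t i := fun i h h' =>
    ht0 ▸ ht (mem_Iic.2 (by omega)) (mem_Iic.2 h') (by omega)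
  have hj := hpos j hj1 hjm
  have hw : ∀ p, p₀ ≤ p → p ≤ m → 0 ≤ weight α γ t p₀ p := fun p h h' =>
    weight_nonneg hγ (hpos p₀ hp1 hpm) ht h h'
  have hK : t j ^ (1 - α) ≤ kernelInt α (t j) 0 (t j) := by
    have := le_kernelInt hα0 hα1 (x := t j) (u := 0) (v := t j) hj le_rfl
    rwa [sub_zero, mul_comm, ← Real.rpow_add_one hj.ne', neg_add_eq_sub] at this
  have hK0 : 0 ≤ kernelInt α (t j) 0 (t j) := (Real.rpow_nonneg hj.le _).trans hK
  have hlin : ∀ p, j ≤ p → p ≤ m →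
      l1Sum α t (barrier α t p) (t j) j = t p ^ (α - 2) * kernelInt α (t j) 0 (t j) :=
    fun p h h' => l1Sum_barrier_of_le ht0 (ht.mono (Iic_subset_Iic.2 h')) _ h
  have hnonneg : ∀ p ∈ Finset.Icc p₀ m,
      0 ≤ weight α γ t p₀ p * l1Sum α t (barrier α t p) (t j) j := by
    intro p hp
    obtain ⟨h1, h2⟩ := Finset.mem_Icc.1 hp
    have hp0 := hpos p (by omega) h2
    refine mul_nonneg (hw p h1 h2) ?_
    rcases le_or_gt j p with h | h
    · rw [hlin p h h2]
      positivity
    · refine le_trans ?_ (hB p j h1 h hjm)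
      have : 0 < 1 - α := by linarith
      positivity
  rcases lt_or_ge j p₀ with h | h
  · calc _ ≤ L ^ (-|2 - α + γ|) * t j ^ (-γ - 1) := by
          gcongr
          exact min_le_right _ _
      _ ≤ t p₀ ^ (-γ) * (t p₀ ^ (α - 2) * kernelInt α (t j) 0 (t j)) := by
          refine barrier_start_lower hα0 hα1 hj (hle _ _ h.le hpm) (hL.trans ?_)
          have h1 := hpos 1 le_rfl (by omega)
          have hL0 : 0 ≤ L := by
            by_contra! hneg
            nlinarith [hpos p₀ hp1 hpm]
          exact mul_le_mul_of_nonneg_left (hle _ _ hj1 hjm) hL0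
      _ = weight α γ t p₀ p₀ * l1Sum α t (barrier α t p₀) (t j) j := by
          rw [hlin p₀ h.le hpm, weight, if_pos rfl]
      _ ≤ _ := Finset.single_le_sum hnonneg (Finset.mem_Icc.2 ⟨le_rfl, hpm⟩)
  · have hα' : 0 < 1 - α := by linarith
    have hBj : ∀ p ∈ Finset.Icc p₀ j,
        (1 - α) / 2 * (t p ^ α * t j ^ (-α - 1)) ≤ l1Sum α t (barrier α t p) (t j) j := by
      intro p hp
      obtain ⟨h1, h2⟩ := Finset.mem_Icc.1 hp
      rcases h2.lt_or_eq with h2 | rfl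
      · exact hB p j h1 h2 hjm
      · rw [hlin p le_rfl hjm, ← Real.rpow_add hj]
        calc _ ≤ 1 * t p ^ (α + (-α - 1)) := by gcongr; linarith
          _ = t p ^ (α - 2) * t p ^ (1 - α) := by
            rw [one_mul, ← Real.rpow_add hj]; congr 1; ring
          _ ≤ _ := by gcongr
    calc _ ≤ (1 - α) / 2 * t j ^ (-γ - 1) := by
          gcongr
          exact min_le_left _ _
      _ = (1 - α) / 2 * t j ^ (-α - 1) *
          ∑ p ∈ Finset.Icc p₀ j, weight α γ t p₀ p * t p ^ α := by
          rw [sum_weight_mul_rpow (fun i h1 h2 => hpos i (by omega) (by omega)) h, mul_assoc,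
            ← Real.rpow_add hj]
          congr 2; ring
      _ ≤ ∑ p ∈ Finset.Icc p₀ j, weight α γ t p₀ p * l1Sum α t (barrier α t p) (t j) j := by
          rw [Finset.mul_sum]
          refine Finset.sum_le_sum fun p hp => ?_
          obtain ⟨h1, h2⟩ := Finset.mem_Icc.1 hp
          have := mul_le_mul_of_nonneg_left (hBj p hp) (hw p h1 (by omega))
          linarith
      _ ≤ _ := Finset.sum_le_sum_of_subset_of_nonneg (Finset.Icc_subset_Icc_right hjm)
          fun p hp _ => hnonneg p hp

theorem abs_le_of_abs_l1Sum_le {α : ℝ} (hα0 : 0 < α) (hα1 : α < 1) {t V W : ℕ → ℝ} {m : ℕ}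
    {c : ℝ} (ht : StrictMonoOn t (Iic m)) (hV0 : V 0 = 0) (hW0 : 0 ≤ c * W 0)
    (h : ∀ j, 1 ≤ j → j ≤ m → |l1Sum α t V (t j) j| ≤ c * l1Sum α t W (t j) j) :
    |V m| ≤ c * W m := by
  have h1 := nonneg_of_l1Sum_nonneg hα0 hα1 (U := fun j => c * W j - V j) ht
    (by simpa [hV0] using hW0)
    (fun j hj hjm => by
      rw [l1Sum_mul_sub]
      linarith [le_abs_self (l1Sum α t V (t j) j), h j hj hjm]) m le_rfl
  have h2 := nonneg_of_l1Sum_nonneg hα0 hα1 (U := fun j => c * W j - -V j) ht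
    (by simpa [hV0] using hW0)
    (fun j hj hjm => by
      rw [l1Sum_mul_sub (V := fun j => -V j), l1Sum_neg]
      linarith [neg_abs_le (l1Sum α t V (t j) j), h j hj hjm]) m le_rfl
  exact abs_le.2 ⟨by linarith, by linarith⟩

/-- Stability of the L1 operator for `γ < α`, with `κ = 1 / r`. -/
theorem exists_stability_const {α γ κ C₀ : ℝ} (hα0 : 0 < α) (hα1 : α < 1) (hγ : γ < α)
    (hκ0 : 0 < κ) (hκ1 : κ ≤ 1) (hκα : α ≤ κ * (2 - α)) (hC₀ : 0 < C₀) :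
    ∃ C : ℝ, 0 < C ∧ ∀ (m : ℕ) (t V : ℕ → ℝ), 1 ≤ m → t 0 = 0 → StrictMonoOn t (Iic m) →
      (∀ i < m, t (i + 1) - t i ≤ C₀ * (t 1 ^ κ * t (i + 1) ^ (1 - κ))) → V 0 = 0 →
      (∀ j, 1 ≤ j → j ≤ m → |deltaL1 α t V j| ≤ (t 1 / t j) ^ (γ + 1)) →
      |V m| ≤ C * Vcal α γ (t 1) (t m) := by
  have hρ : 0 < 2 * κ - α := by nlinarith
  obtain ⟨K, hK, hthr⟩ := exists_ratio_threshold (α := α) (κ := κ) (C := C₀) (ρ := 2 * κ - α)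
    hα0 hα1 hκ0
  obtain ⟨A, hA, hsum⟩ := exists_sum_weight_le_Vcal hα0 hα1 hγ
  set L := max (2 * K) ((2 * C₀) ^ (1 / κ)) with hLdef
  have hL : 0 < L := lt_of_lt_of_le (by linarith) (le_max_left _ _)
  set c := min ((1 - α) / 2) (L ^ (-|2 - α + γ|)) with hc
  have hc0 : 0 < c := lt_min (by linarith) (by positivity)
  have hG : 0 < Real.Gamma (1 - α) := Real.Gamma_pos_of_pos (by linarith)
  refine ⟨Real.Gamma (1 - α) / c * A, by positivity, fun m t V hm ht0 ht hstep hV0 hV => ?_⟩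
  have hle : ∀ i k, i ≤ k → k ≤ m → t i ≤ t k := fun i k h h' =>
    ht.monotoneOn (mem_Iic.2 (by omega)) (mem_Iic.2 h') h
  have hpos : ∀ i, 1 ≤ i → i ≤ m → 0 < t i := fun i h h' =>
    ht0 ▸ ht (mem_Iic.2 (by omega)) (mem_Iic.2 h') (by omega)
  have hτ := hpos 1 le_rfl hm
  obtain ⟨p₀, hp1, hpm, hpL, hpK⟩ := exists_start_node hκ0 hC₀ hK hτ rfl hm hpos hstep
  have hB : ∀ p n, p₀ ≤ p → p < n → n ≤ m →
      (1 - α) / 2 * (t p ^ α * t n ^ (-α - 1)) ≤ l1Sum α t (barrier α t p) (t n) n := by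
    intro p n hp hpn hn
    have hKp : K * t 1 ≤ t p := by
      rcases hpK with h | h
      · omega
      · exact h.trans (hle _ _ hp (by omega))
    have hp0 := hpos p (by omega) (by omega)
    obtain ⟨e1, e2, e3⟩ := hthr (t 1 / t p) (div_pos hτ hp0)
      (by rw [← mul_div_assoc]; exact (div_le_one hp0).2 hKp)
    exact l1Sum_barrier_lower hα0 hα1 hκ1 hκ0 hρ hκα hC₀ hτ ht0
      (ht.mono (Iic_subset_Iic.2 hn)) hpn.le (hle _ _ (by omega) (by omega))
      (fun i hi => hstep i (by omega)) e1 e2 e3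
  have hcomp := abs_le_of_abs_l1Sum_le hα0 hα1 (V := V) (c := Real.Gamma (1 - α) / c * t 1 ^ (γ + 1))
    (W := fun j => ∑ p ∈ Finset.Icc p₀ m, weight α γ t p₀ p * barrier α t p j) ht hV0
    (by simp [barrier, ht0]) fun j hj hjm => by
      have h1 := l1Sum_weighted_barrier_lower hα0 hα1 hγ ht0 ht hp1 hpm hpL hB hj hjm
      have h2 := hV j hj hjm
      have hj0 := hpos j hj hjm
      rw [deltaL1_eq hα1, abs_mul, abs_of_pos (by positivity), one_div, inv_mul_le_iff₀ hG] at h2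
      calc _ ≤ _ := h2
        _ = Real.Gamma (1 - α) / c * t 1 ^ (γ + 1) * (c * t j ^ (-γ - 1)) := by
          rw [Real.div_rpow hτ.le hj0.le, show -γ - 1 = -(γ + 1) by ring, Real.rpow_neg hj0.le]
          field_simp
        _ ≤ _ := by gcongr
  refine hcomp.trans ?_
  have hW : ∑ p ∈ Finset.Icc p₀ m, weight α γ t p₀ p * barrier α t p m =
      t m ^ (α - 1) * ∑ p ∈ Finset.Icc p₀ m, weight α γ t p₀ p := by
    rw [Finset.mul_sum]
    refine Finset.sum_congr rfl fun p hp => ?_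
    rw [barrier_of_le (hpos m hm le_rfl) (Finset.mem_Icc.1 hp).2, mul_comm]
  rw [hW, mul_assoc, mul_assoc]
  exact mul_le_mul_of_nonneg_left
    (hsum t (t 1) p₀ m hτ (hle _ _ hp1 hpm) hpm ht) (by positivity)

/-- Stability of the L1 operator under the weaker quasi-gradedness condition
(Lemma 2.8). -/
theorem stmt9 (α r γ T c0 C0 : ℝ)
    (hα0 : 0 < α) (hα1 : α < 1)
    (hr1 : 1 ≤ r) (hr2 : r ≤ (2 - α) / α)
    (hT : 0 < T) (hc0 : 0 < c0) (hcC : c0 ≤ C0) :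
    ∃ C : ℝ, 0 < C ∧
      ∀ (M : ℕ) (t : ℕ → ℝ), IsMesh T M t → WeakQuasiGraded r c0 C0 M t →
        ∀ V : ℕ → ℝ, V 0 = 0 →
          (∀ j : ℕ, 1 ≤ j → j ≤ M → |deltaL1 α t V j| ≤ (t 1 / t j) ^ (γ + 1)) →
          ∀ j : ℕ, 1 ≤ j → j ≤ M → |V j| ≤ C * Vcal α γ (t 1) (t j) := by
  have hr0 : 0 < r := by linarith
  have hC₀ : 0 < C0 := by linarith
  rw [le_div_iff₀ hα0] at hr2
  obtain ⟨C, hC, h⟩ := exists_stability_const (α := α) (γ := min γ (α / 2)) (κ := 1 / r) (C₀ := C0)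
    hα0 hα1 ((min_le_right _ _).trans_lt (by linarith)) (by positivity)
    ((div_le_one hr0).2 hr1)
    (by rw [one_div_mul_eq_div, le_div_iff₀ hr0]; linarith) hC₀
  refine ⟨C, hC, fun M t ⟨hM, ht0, hmesh, _⟩ ⟨_, hgrade⟩ V hV0 hV j hj hjM => ?_⟩
  have hmono : StrictMonoOn t (Iic M) := strictMonoOn_Iic_of_lt_succ hmesh
  have hmono_j : StrictMonoOn t (Iic j) := hmono.mono (Iic_subset_Iic.2 hjM)
  rw [← Vcal_min hα0]
  refine h j t V hj ht0 hmono_j (fun i hi => ?_) hV0 fun k hk hkj => ?_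
  · exact hgrade (i + 1) (by omega) (by omega)
  · have h1 : 0 < t 1 := ht0 ▸ hmesh 0 (by omega)
    have h2 : t 1 ≤ t k :=
      hmono.monotoneOn (mem_Iic.2 (by omega)) (mem_Iic.2 (by omega)) hk
    have h3 : 0 < t k := h1.trans_le h2
    exact (hV k hk (by omega)).trans (Real.rpow_le_rpow_of_exponent_ge (by positivity)
      ((div_le_one h3).2 h2) (by linarith [min_le_left γ (α / 2)]))
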